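/- arXiv:1312.6344 — 2 statements merged into one kernel-verified Lean document; each statement's English description precedes it below -/
import Mathlib

section
/- Let σ and τ be permutations of a finite set W, and over GF(2) let d₂ : 𝓕 → 𝓦 and d₁ : 𝓦 → 𝓥 be the linear maps defined by d₂(f) = Σ_{i∈f} w_i for each face f (each orbit of στ⁻¹) and d₁(w_i) = v(i) + v(τ⁻¹(i)) for each dart i. Then d₁ ∘ d₂ = 0. -/
/-- The set of orbits of a permutation `g` of `W` (the orbits of the cyclic group `⟨g⟩`). -/
abbrev PermOrbits {W : Type*} (g : Equiv.Perm W) : Type _ :=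
  MulAction.orbitRel.Quotient (Subgroup.zpowers g) W

/-- The orbit of the permutation `g` containing the point `i`. -/
abbrev PermOrbits.mk {W : Type*} (g : Equiv.Perm W) (i : W) : PermOrbits g :=
  Quotient.mk'' i

theorem PermOrbits.mk_apply {W : Type*} (g : Equiv.Perm W) (i : W) :
    PermOrbits.mk g (g i) = PermOrbits.mk g i :=
  Quotient.sound' ⟨⟨g, Subgroup.mem_zpowers g⟩, rfl⟩

open Classical in
/-- **`d₁ ∘ d₂ = 0` for a hypermap.**
Let `σ` and `τ` be permutations of a finite set `W` of darts; the vertices are the orbits of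
`σ` and the faces are the orbits of `στ⁻¹`.  Over GF(2), let `d₂ : 𝓕 → 𝓦` be the linear map
sending each face `f` to `Σ_{i ∈ f} w_i` (the indicator vector of the darts in `f`) and let
`d₁ : 𝓦 → 𝓥` be the linear map sending each dart `i` to `v(i) + v(τ⁻¹(i))`, where `v(i)` is
the `σ`-orbit (vertex) containing `i`.  Then `d₁ ∘ d₂ = 0`. -/
theorem hypermap_d1_comp_d2_eq_zero {W : Type*} [Fintype W] (σ τ : Equiv.Perm W)
    (d₂ : (PermOrbits (σ * τ⁻¹) → ZMod 2) →ₗ[ZMod 2] (W → ZMod 2))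
    (d₁ : (W → ZMod 2) →ₗ[ZMod 2] (PermOrbits σ → ZMod 2))
    (hd₂ : ∀ f : PermOrbits (σ * τ⁻¹),
      d₂ (Pi.single f 1) = fun i => if PermOrbits.mk (σ * τ⁻¹) i = f then 1 else 0)
    (hd₁ : ∀ i : W,
      d₁ (Pi.single i 1) =
        Pi.single (PermOrbits.mk σ i) 1 + Pi.single (PermOrbits.mk σ (τ⁻¹ i)) 1) :
    d₁ ∘ₗ d₂ = 0 := by
  have hd₁' (i : W) : d₁ (Pi.single i 1) =
      Pi.single (PermOrbits.mk σ i) 1 + Pi.single (PermOrbits.mk σ ((σ * τ⁻¹) i)) 1 := by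
    rw [hd₁, Equiv.Perm.mul_apply, PermOrbits.mk_apply]
  generalize σ * τ⁻¹ = g at *
  refine LinearMap.pi_ext' fun f => LinearMap.ext_ring ?_
  have hsum : d₂ (Pi.single f 1) =
      ∑ i, (if PermOrbits.mk g i = f then (1 : ZMod 2) else 0) • Pi.single i (1 : ZMod 2) := by
    rw [hd₂]
    exact pi_eq_sum_univ' _
  have hshift := Equiv.sum_comp g fun i =>
    (if PermOrbits.mk g i = f then (1 : ZMod 2) else 0) •
      (Pi.single (PermOrbits.mk σ i) 1 : PermOrbits σ → ZMod 2)
  simp only [PermOrbits.mk_apply] at hshift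
  simp only [LinearMap.comp_apply, LinearMap.single_apply, LinearMap.zero_apply]
  rw [hsum, map_sum]
  simp only [map_smul, hd₁', smul_add, Finset.sum_add_distrib]
  rw [hshift]
  exact funext fun v => CharTwo.add_self_eq_zero _
end

section
/- Let τ be a permutation of a finite set W, let ι : 𝓔 → 𝓦 over GF(2) send each τ-orbit e to Σ_{i∈e} w_i, and let p : 𝓦 → 𝓦/ι(𝓔) be the quotient map. Let S ⊆ W be a set of special darts containing exactly one dart from each τ-orbit. Then the images {p(w_i) : i ∈ W∖S} of the nonspecial darts form a basis of the quotient space 𝓦/ι(𝓔). -/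
section Transversal

variable {R W E : Type*} [CommRing R] (q : W → E) {S : Set W}

/-- A linear map sending each basis vector `e` to the indicator function of the fibre of `q`
over `e` is precomposition with `q`. -/
theorem linearMap_eq_funLeft_of_apply_single [Finite E] [DecidableEq E]
    (ι : (E → R) →ₗ[R] (W → R))
    (hι : ∀ e, ι (Pi.single e 1) = fun i => if q i = e then 1 else 0) :
    ι = LinearMap.funLeft R R q := by
  refine LinearMap.pi_ext' fun e => LinearMap.ext_ring ?_
  ext i
  simp [hι, LinearMap.funLeft_apply, Pi.single_apply]

variable [Fintype W] [DecidableEq W]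

/-- Basis vectors outside a set meeting every fibre of `q` stay linearly independent modulo the
functions that factor through `q`. -/
theorem linearIndependent_mkQ_single_compl (hS : ∀ e, ∃ s ∈ S, q s = e) :
    LinearIndependent R (fun i : (Sᶜ : Set W) =>
      (LinearMap.range (LinearMap.funLeft R R q)).mkQ (Pi.single (i : W) (1 : R))) := by
  classical
  rw [Fintype.linearIndependent_iff]
  intro g hg i
  simp only [← map_smul] at hg
  rw [← map_sum, Submodule.mkQ_apply, Submodule.Quotient.mk_eq_zero] at hg
  obtain ⟨f, hf⟩ := hg
  have hf_apply (j : W) : f (q j) = ∑ k : (Sᶜ : Set W), g k * (Pi.single (k : W) 1 : W → R) j := by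
    simpa [LinearMap.funLeft_apply] using congrFun hf j
  have hf_zero (e : E) : f e = 0 := by
    obtain ⟨s, hs, rfl⟩ := hS e
    rw [hf_apply]
    refine Finset.sum_eq_zero fun k _ => ?_
    have hk : s ≠ k := fun h => k.2 (h ▸ hs)
    rw [Pi.single_eq_of_ne hk, mul_zero]
  have hi := hf_apply i
  rw [hf_zero, Finset.sum_eq_single i
    (fun k _ hk => by rw [Pi.single_eq_of_ne (Subtype.coe_ne_coe.mpr hk.symm), mul_zero])
    (by simp)] at hi
  simpa using hi.symm

/-- Basis vectors outside a set meeting every fibre of `q` at most once span the functions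
modulo those that factor through `q`. -/
theorem span_mkQ_single_compl_eq_top (hS : Set.InjOn q S) :
    Submodule.span R (Set.range fun i : (Sᶜ : Set W) =>
      (LinearMap.range (LinearMap.funLeft R R q)).mkQ (Pi.single (i : W) (1 : R))) = ⊤ := by
  classical
  rw [eq_top_iff]
  rintro x -
  obtain ⟨v, rfl⟩ := Submodule.mkQ_surjective _ x
  obtain ⟨f, hf⟩ : ∃ f : E → R, ∀ s ∈ S, f (q s) = v s := by
    refine ⟨fun e => if h : ∃ s ∈ S, q s = e then v h.choose else 0, fun s hs => ?_⟩
    have h : ∃ t ∈ S, q t = q s := ⟨s, hs, rfl⟩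
    simp only [dif_pos h]
    rw [hS h.choose_spec.1 hs h.choose_spec.2]
  have hv : (LinearMap.range (LinearMap.funLeft R R q)).mkQ v =
      (LinearMap.range (LinearMap.funLeft R R q)).mkQ (v - LinearMap.funLeft R R q f) := by
    rw [← sub_eq_zero, ← map_sub, Submodule.mkQ_apply, Submodule.Quotient.mk_eq_zero]
    exact ⟨f, by abel⟩
  rw [hv, pi_eq_sum_univ' (v - LinearMap.funLeft R R q f), map_sum]
  refine Submodule.sum_mem _ fun i _ => ?_
  rw [map_smul]
  by_cases hi : i ∈ S
  · simp [LinearMap.funLeft_apply, hf i hi]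
  · refine Submodule.smul_mem _ _ (Submodule.subset_span ⟨⟨i, hi⟩, ?_⟩)
    congr 1

end Transversal

open Classical in
/-- **The nonspecial darts give a (special) basis of `𝓦/ι(𝓔)`.**
Let `τ` be a permutation of a finite set `W` of darts, with hyperedges the orbits of `τ`;
over GF(2) let `ι : 𝓔 → 𝓦` send each `τ`-orbit `e` to `Σ_{i ∈ e} w_i`, and let
`p : 𝓦 → 𝓦/ι(𝓔)` be the quotient map.  If `S ⊆ W` is a set of special darts containing
exactly one dart from each `τ`-orbit, then the images `{p(w_i) : i ∈ W∖S}` of the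
nonspecial darts form a basis of the quotient space `𝓦/ι(𝓔)`:  they are linearly
independent and span the whole quotient. -/
theorem hypermap_nonspecial_darts_form_basis {W : Type*} [Fintype W] (τ : Equiv.Perm W)
    (ι : (PermOrbits τ → ZMod 2) →ₗ[ZMod 2] (W → ZMod 2))
    (hι : ∀ e : PermOrbits τ,
      ι (Pi.single e 1) = fun i => if PermOrbits.mk τ i = e then 1 else 0)
    (S : Set W)
    (hS : ∀ e : PermOrbits τ, ∃! s : W, s ∈ S ∧ PermOrbits.mk τ s = e) :
    LinearIndependent (ZMod 2)
      (fun i : (Sᶜ : Set W) =>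
        (LinearMap.range ι).mkQ (Pi.single (i : W) (1 : ZMod 2))) ∧
    Submodule.span (ZMod 2)
      (Set.range fun i : (Sᶜ : Set W) =>
        (LinearMap.range ι).mkQ (Pi.single (i : W) (1 : ZMod 2))) = ⊤ := by
  obtain rfl := linearMap_eq_funLeft_of_apply_single (PermOrbits.mk τ) ι hι
  refine ⟨linearIndependent_mkQ_single_compl _ fun e => (hS e).exists,
    span_mkQ_single_compl_eq_top _ fun s hs t ht h => ?_⟩
  exact (hS _).unique ⟨hs, h⟩ ⟨ht, rfl⟩
end
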